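/- Let X = (X_n)_{n≥0} be the final-letter process of a SVLMC defined by an irreducible probabilized infinite comb with stationary measure π, and let w = w₁…w_k be a finite word of length k ≥ 1 such that w̄ is not an internal node of the context tree. Then for |x| < 1 the generating function of the first occurrence of w is Φ_w^{(1)}(x) = x^k π(w) / ((1−x) S_w(x)), and the generating function of the r-th occurrence is Φ_w^{(r)}(x) = Φ_w^{(1)}(x)·(1 − 1/S_w(x))^{r−1}, where S_w(x) = C_w(x) + ∑_{j=k}^{∞} q_{pref(w)}^{(j)}(w) x^j and C_w(x) = 1 + ∑_{j=1}^{k−1} 1[w_{j+1}…w_k = w₁…w_{k−j}] · q_{pref(w)}^{(j)}(w_{k−j+1}…w_k) x^j. -/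

import Mathlib

open MeasureTheory
open ProbabilityTheory (Kernel IsMarkovKernel)
open scoped ENNReal

namespace VLMC

/-- Left-infinite sequences over the alphabet `{0,1}`; `s 0` is the rightmost
(most recent) letter, `s 1` the one before it, etc. -/
abbrev L : Type := ℕ → Bool

/-- Append the letter `b` on the right of the left-infinite sequence `s`. -/
def extend (b : Bool) (s : L) : L := fun n => match n with
  | 0 => b
  | k + 1 => s k

/-- Sequences whose letters, read from the rightmost one leftwards, start with `u`. -/
def cylRev (u : List Bool) : Set L := {s | ∀ i < u.length, s i = u.getD i false}

/-- The cylinder `Lw` of left-infinite sequences admitting the finite word `w` as a suffix. -/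
def cyl (w : List Bool) : Set L := cylRev w.reverse

/-- `π` is a stationary (invariant) probability measure for the kernel `κ`. -/
def IsStationary (κ : Kernel L L) (π : Measure L) : Prop :=
  ∀ B : Set L, MeasurableSet B → π B = ∫⁻ s, κ s B ∂π

/-- `cₙ = ∏_{k=0}^{n-1} q_{0ᵏ1}(0)` (with `c₀ = 1`), for the infinite comb. -/
noncomputable def combC (q : ℕ → Bool → ℝ≥0∞) (n : ℕ) : ℝ≥0∞ :=
  ∏ k ∈ Finset.range n, q k false

/-- The left-infinite sequence `0^∞`. -/
def zeroSeq : L := fun _ => false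

/-- `κ` is the transition kernel of the VLMC associated with the probabilized
infinite comb whose contexts are the words `0ⁿ1`, `n ≥ 0` (with probability
measures `q n` on the alphabet) and the infinite word `0^∞` (with probability
measure `qinf`) : from a state with context `0ⁿ1` (i.e. ending with `10ⁿ`),
a letter `α` is appended on the right with probability `q n α`, and from the
state `0^∞` with probability `qinf α`. -/
def IsCombKernel (q : ℕ → Bool → ℝ≥0∞) (qinf : Bool → ℝ≥0∞) (κ : Kernel L L) : Prop :=
  (∀ (n : ℕ) (s : L), s ∈ cylRev (List.replicate n false ++ [true]) →
      κ s = q n false • Measure.dirac (extend false s)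
          + q n true • Measure.dirac (extend true s)) ∧
  κ zeroSeq = qinf false • Measure.dirac (extend false zeroSeq)
            + qinf true • Measure.dirac (extend true zeroSeq)

attribute [local instance] Classical.propDecidable

/-- The transition probability of the infinite comb from the state `s` :
the context of `s` is `0ⁿ1` where `n` is the number of leading zeros of `s`
(starting from the rightmost letter), and `0^∞` if `s` has no `1`. -/
noncomputable def combTheta (q : ℕ → Bool → ℝ≥0∞) (qinf : Bool → ℝ≥0∞)
    (s : L) (b : Bool) : ℝ≥0∞ :=
  if h : ∃ n, s n = true then q (Nat.find h) b else qinf b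

/-- Probability that, starting from the past `s`, the comb chain emits the
letters of the word `v` (in chronological order) during its next `|v|` steps. -/
noncomputable def combWordProb (q : ℕ → Bool → ℝ≥0∞) (qinf : Bool → ℝ≥0∞) :
    L → List Bool → ℝ≥0∞
  | _, [] => 1
  | s, b :: v => combTheta q qinf s b * combWordProb q qinf (extend b s) v

/-- The canonical past ending with the finite word `v` (and `0^∞` before `v`). -/
def pastOfWord (v : List Bool) : L := fun i => v.reverse.getD i false

/-- `q_c⁽ʲ⁾(u) = P(X_{j-|u|+1} … X_j = u | X_{-(|c|-1)} … X_0 = c̄)`, the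
conditional probability that the `|u|` letters emitted at times `j-|u|+1, …, j`
form the word `u`, given a past; the intermediate letters are summed out. -/
noncomputable def qcond (q : ℕ → Bool → ℝ≥0∞) (qinf : Bool → ℝ≥0∞)
    (past : L) (j : ℕ) (u : List Bool) : ℝ≥0∞ :=
  ∑ v : Fin (j - u.length) → Bool, combWordProb q qinf past (List.ofFn v ++ u)

/-- `w` occurs at position `t` in the word `v = X₁…X_n` (i.e. `X_{t-k+1}…X_t = w`). -/
def occursAt (w v : List Bool) (t : ℕ) : Bool :=
  decide (w.length ≤ t ∧ t ≤ v.length ∧ (v.take t).drop (t - w.length) = w)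

/-- the `r`-th occurrence of `w` in `v` is at position `t`. -/
def isRthOcc (w v : List Bool) (r t : ℕ) : Bool :=
  occursAt w v t && ((List.range t).countP (occursAt w v) == r - 1)

/-- `P(T_w⁽ʳ⁾ = n)` : the probability (under the stationary chain, expressed
through the stationary measure of cylinders) that the `r`-th occurrence of `w`
in `X₁ X₂ …` ends at position `n`. -/
noncomputable def probOcc (π : Measure L) (w : List Bool) (r n : ℕ) : ℝ :=
  ∑ v : Fin n → Bool,
    if isRthOcc w (List.ofFn v) r n then (π (cyl (List.ofFn v))).toReal else 0

/-- The generating function `Φ_w⁽ʳ⁾(x) = ∑ₙ P(T_w⁽ʳ⁾ = n) xⁿ`. -/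
noncomputable def genFun (π : Measure L) (w : List Bool) (r : ℕ) (x : ℝ) : ℝ :=
  ∑' n : ℕ, probOcc π w r n * x ^ n

/-- The (generalized probabilized) autocorrelation polynomial `C_w(x)`. -/
noncomputable def Cw (q : ℕ → Bool → ℝ≥0∞) (qinf : Bool → ℝ≥0∞)
    (past : L) (w : List Bool) (x : ℝ) : ℝ :=
  1 + ∑ j ∈ Finset.Ico 1 w.length,
    (if w.drop j = w.take (w.length - j) then
       (qcond q qinf past j (w.drop (w.length - j))).toReal * x ^ j
     else 0)

/-- `S_w(x) = C_w(x) + ∑_{j ≥ k} q_{pref(w)}⁽ʲ⁾(w) xʲ`. -/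
noncomputable def Sw (q : ℕ → Bool → ℝ≥0∞) (qinf : Bool → ℝ≥0∞)
    (past : L) (w : List Bool) (x : ℝ) : ℝ :=
  Cw q qinf past w x
    + ∑' j : ℕ, (qcond q qinf past (w.length + j) w).toReal * x ^ (w.length + j)

/-- The canonical past with context `pref(w) = 0ᵐ1`, `m` the number of trailing
zeros of `w` : it ends with the word `10ᵐ = pref(w)‾`. -/
def combPast (w : List Bool) : L :=
  pastOfWord (true :: List.replicate (w.reverse.takeWhile (fun x => !x)).length false)

section Words

/-- Splitting a sum over words of length `m + d` at position `m`. -/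
lemma sum_ofFn_add (m d : ℕ) (f : List Bool → ℝ) :
    ∑ v : Fin (m + d) → Bool, f (List.ofFn v)
      = ∑ a : Fin m → Bool, ∑ u : Fin d → Bool, f (List.ofFn a ++ List.ofFn u) := by
  rw [← Fintype.sum_prod_type', ← Equiv.sum_comp (Fin.appendEquiv m d)]
  exact Finset.sum_congr rfl fun p _ => by simp [Fin.appendEquiv, List.ofFn_fin_append]

/-- Splitting off the first letter in a sum over words. -/
lemma sum_ofFn_succ {M : Type*} [AddCommMonoid M] (d : ℕ) (f : List Bool → M) :
    ∑ v : Fin (d + 1) → Bool, f (List.ofFn v)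
      = ∑ u : Fin d → Bool, (f (false :: List.ofFn u) + f (true :: List.ofFn u)) := by
  rw [← Equiv.sum_comp (Fin.consEquiv fun _ => Bool), Fintype.sum_prod_type_right]
  exact Finset.sum_congr rfl fun p _ => by
    simp [Fin.consEquiv, List.ofFn_succ, add_comm]

lemma sum_ofFn_eq (l : List Bool) (f : List Bool → ℝ) :
    ∑ u : Fin l.length → Bool, (if List.ofFn u = l then f (List.ofFn u) else 0) = f l := by
  rw [Finset.sum_eq_single l.get]
  · simp
  · intro u _ hu
    rw [if_neg]
    intro h
    apply hu
    apply List.ofFn_injective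
    simpa using h
  · simp

lemma isSuffix_append_iff_of_length_eq {w v u : List Bool} (h : w.length = u.length) :
    w <:+ v ++ u ↔ u = w := by
  constructor
  · rintro ⟨a, ha⟩
    exact (List.append_inj_right' ha h).symm
  · rintro rfl
    exact List.suffix_append _ _

lemma isSuffix_append_congr {w a u : List Bool} (h : w <:+ a) :
    w <:+ a ++ u ↔ w <:+ w ++ u := by
  obtain ⟨b, rfl⟩ := h
  constructor
  · intro h'
    refine List.suffix_of_suffix_length_le h' ⟨b, by simp⟩ (by simp)
  · intro h'
    exact h'.trans ⟨b, by simp⟩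

lemma isSuffix_self_append_iff {w u : List Bool} (h : u.length ≤ w.length) :
    w <:+ w ++ u ↔
      w.drop u.length = w.take (w.length - u.length) ∧ u = w.drop (w.length - u.length) := by
  have key : w.drop u.length ++ u <:+ w ++ u := ⟨w.take u.length, by
    rw [← List.append_assoc, List.take_append_drop]⟩
  have hlen : (w.drop u.length ++ u).length = w.length := by simp; omega
  have h1 : w <:+ w ++ u ↔ w = w.drop u.length ++ u := by
    constructor
    · intro h'
      exact (List.suffix_of_suffix_length_le h' key (by omega)).eq_of_length hlen.symm
    · intro h'
      conv_lhs => rw [h']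
      exact key
  rw [h1]
  constructor
  · intro h'
    have h2 : w.take (w.length - u.length) ++ w.drop (w.length - u.length)
        = w.drop u.length ++ u := by rw [List.take_append_drop]; exact h'
    obtain ⟨h3, h4⟩ := List.append_inj h2 (by simp)
    exact ⟨h3.symm, h4.symm⟩
  · rintro ⟨h3, h4⟩
    conv_rhs => rw [h3]
    conv_rhs => arg 2; rw [h4]
    rw [List.take_append_drop]

lemma occursAt_length {w v : List Bool} : occursAt w v v.length = true ↔ w <:+ v := by
  simp only [occursAt, decide_eq_true_eq, le_refl, true_and, List.take_length]
  constructor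
  · rintro ⟨_, h⟩
    exact h ▸ List.drop_suffix _ _
  · intro h
    exact ⟨h.length_le, (List.suffix_iff_eq_drop.mp h).symm⟩

lemma occursAt_append {w a u : List Bool} {t : ℕ} (ht : t ≤ a.length) :
    occursAt w (a ++ u) t = occursAt w a t := by
  have : t ≤ (a ++ u).length := by simp; omega
  simp only [occursAt, List.take_append_of_le_length ht, ht, this]

lemma countP_occursAt_append {w a u : List Bool} {t : ℕ} (ht : t ≤ a.length) :
    (List.range t).countP (occursAt w (a ++ u)) = (List.range t).countP (occursAt w a) :=
  List.countP_congr fun i hi => by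
    rw [occursAt_append ((List.mem_range.mp hi).le.trans ht)]

lemma isRthOcc_append {w a u : List Bool} (r : ℕ) {t : ℕ} (ht : t ≤ a.length) :
    isRthOcc w (a ++ u) r t = isRthOcc w a r t := by
  rw [isRthOcc, isRthOcc, occursAt_append ht, countP_occursAt_append ht]

/-- Exactly one position carries the `(r+1)`-th occurrence, as soon as there are more than `r`
occurrences. -/
lemma sum_isRthOcc (w v : List Bool) (r N : ℕ) :
    ∑ m ∈ Finset.range N, (if isRthOcc w v (r + 1) m then (1 : ℝ) else 0)
      = if r < (List.range N).countP (occursAt w v) then 1 else 0 := by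
  induction N with
  | zero => simp
  | succ N ih =>
    rw [Finset.sum_range_succ, ih, List.range_succ, List.countP_append]
    by_cases h : occursAt w v N
    · simp only [isRthOcc, h, List.countP_singleton]
      rcases lt_trichotomy r ((List.range N).countP (occursAt w v)) with h' | h' | h'
      · have h2 : (List.range N).countP (occursAt w v) ≠ r := by omega
        simp [h', h2, show r < (List.range N).countP (occursAt w v) + 1 by omega]
      · simp [← h']
      · have h2 : (List.range N).countP (occursAt w v) ≠ r := by omega
        simp [h2, not_lt.mpr h'.le,
          show ¬ r < (List.range N).countP (occursAt w v) + 1 by omega]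
    · simp [isRthOcc, h]

end Words

section Cylinders

lemma mem_cylRev_cons {s : L} {b : Bool} {u : List Bool} :
    s ∈ cylRev (b :: u) ↔ s 0 = b ∧ (fun n => s (n + 1)) ∈ cylRev u := by
  simp only [cylRev, Set.mem_ofPred_eq, List.length_cons]
  constructor
  · intro h
    exact ⟨by simpa using h 0 (by omega), fun i hi => by simpa using h (i + 1) (by omega)⟩
  · rintro ⟨h0, h⟩ (_ | i) hi
    · simpa using h0
    · simpa using h i (by omega)

lemma extend_mem_cyl {s : L} {b c : Bool} {v : List Bool} :
    extend c s ∈ cyl (v ++ [b]) ↔ c = b ∧ s ∈ cyl v := by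
  rw [cyl, List.reverse_append, List.reverse_singleton, List.singleton_append, mem_cylRev_cons]
  rfl

lemma cylRev_append_subset (u v : List Bool) : cylRev (u ++ v) ⊆ cylRev u := by
  intro s hs i hi
  rw [hs i (by simp; omega), List.getD_append _ _ _ _ hi]

lemma cyl_anti {w v : List Bool} (h : w <:+ v) : cyl v ⊆ cyl w := by
  obtain ⟨a, rfl⟩ := h
  rw [cyl, List.reverse_append]
  exact cylRev_append_subset _ _

lemma mem_cylRev_append_singleton {s : L} {u : List Bool} {b : Bool} :
    s ∈ cylRev (u ++ [b]) ↔ s ∈ cylRev u ∧ s u.length = b := by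
  constructor
  · intro h
    exact ⟨cylRev_append_subset _ _ h, by simpa using h u.length (by simp)⟩
  · rintro ⟨h, hb⟩ i hi
    simp only [List.length_append, List.length_singleton] at hi
    rcases (Nat.lt_succ_iff_lt_or_eq.mp hi) with h' | rfl
    · rw [h i h', List.getD_append _ _ _ _ h']
    · simp [hb]

lemma measurableSet_cylRev (u : List Bool) : MeasurableSet (cylRev u) := by
  have : cylRev u = ⋂ i ∈ Finset.range u.length, (fun s : L => s i) ⁻¹' {u.getD i false} := by
    ext s; simp [cylRev]
  rw [this]
  exact Finset.measurableSet_biInter _ fun i _ =>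
    measurable_pi_apply i (measurableSet_singleton _)

lemma measurableSet_cyl (v : List Bool) : MeasurableSet (cyl v) := measurableSet_cylRev _

/-- The set of pasts whose context is `0ⁿ1`. -/
abbrev contextSet (n : ℕ) : Set L := cylRev (List.replicate n false ++ [true])

lemma mem_contextSet {s : L} {n : ℕ} : s ∈ contextSet n ↔ s n = true ∧ ∀ i < n, s i = false := by
  rw [mem_cylRev_append_singleton, and_comm, List.length_replicate]
  refine and_congr_right fun _ => ?_
  simp +contextual [cylRev]

lemma extend_true_mem_contextSet (s : L) : extend true s ∈ contextSet 0 := by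
  simp [mem_contextSet, extend]

lemma extend_false_mem_contextSet {s : L} {n : ℕ} (hs : s ∈ contextSet n) :
    extend false s ∈ contextSet (n + 1) := by
  rw [contextSet, List.replicate_succ, List.cons_append, mem_cylRev_cons]
  exact ⟨rfl, hs⟩

lemma cyl_append_true_subset (v : List Bool) : cyl (v ++ [true]) ⊆ contextSet 0 := by
  intro s hs
  exact cyl_anti (List.suffix_append v [true]) hs

lemma cyl_append_false_subset {v : List Bool} {n : ℕ} (hv : cyl v ⊆ contextSet n) :
    cyl (v ++ [false]) ⊆ contextSet (n + 1) := by
  intro s hs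
  rw [cyl, List.reverse_append, List.reverse_singleton, List.singleton_append,
    mem_cylRev_cons] at hs
  rw [contextSet, List.replicate_succ, List.cons_append, mem_cylRev_cons]
  exact ⟨hs.1, hv hs.2⟩

lemma exists_mem_contextSet_or_eq (s : L) : (∃ n, s ∈ contextSet n) ∨ s = zeroSeq := by
  by_cases h : ∃ n, s n = true
  · left
    refine ⟨Nat.find h, mem_contextSet.mpr ⟨Nat.find_spec h, fun i hi => ?_⟩⟩
    simpa using Nat.find_min h hi
  · right
    funext n
    simpa [zeroSeq] using not_exists.mp h n

lemma combTheta_of_mem (q : ℕ → Bool → ℝ≥0∞) (qinf : Bool → ℝ≥0∞) {s : L} {n : ℕ}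
    (hs : s ∈ contextSet n) (b : Bool) : combTheta q qinf s b = q n b := by
  rw [mem_contextSet] at hs
  have h : ∃ n, s n = true := ⟨n, hs.1⟩
  rw [combTheta, dif_pos h]
  congr 1
  rw [Nat.find_eq_iff]
  exact ⟨hs.1, fun i hi => by simp [hs.2 i hi]⟩

lemma cyl_subset_contextSet {w : List Bool} (hw : true ∈ w) :
    cyl w ⊆ contextSet (w.reverse.takeWhile (fun x => !x)).length := by
  set p : Bool → Bool := fun x => !x
  have h1 : w.reverse.takeWhile p
      = List.replicate (w.reverse.takeWhile p).length false := by
    refine List.eq_replicate_of_mem fun b hb => ?_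
    simpa [p] using List.mem_takeWhile_imp hb
  have hne : w.reverse.dropWhile p ≠ [] := by
    rw [Ne, List.dropWhile_eq_nil_iff]
    intro h
    simpa [p] using h true (by simpa using hw)
  obtain ⟨b, l, hl⟩ := List.exists_cons_of_ne_nil hne
  have hb : b = true := by
    have := List.head_dropWhile_not p hne
    simpa [hl, p] using this
  have h2 : w.reverse
      = (List.replicate (w.reverse.takeWhile p).length false ++ [true]) ++ l := by
    conv_lhs => rw [← List.takeWhile_append_dropWhile (p := p) (l := w.reverse), h1, hl, hb]
    simp
  rw [cyl]
  conv_lhs => rw [h2]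
  exact cylRev_append_subset _ _

lemma combPast_mem_contextSet (w : List Bool) :
    combPast w ∈ contextSet (w.reverse.takeWhile (fun x => !x)).length := by
  intro i _
  simp [combPast, pastOfWord]

end Cylinders

section Chain

variable {q : ℕ → Bool → ℝ≥0∞} {qinf : Bool → ℝ≥0∞} {κ : Kernel L L} {π : Measure L}

lemma kernel_apply_cyl (hκ : IsCombKernel q qinf κ) (s : L) (v : List Bool) (b : Bool) :
    κ s (cyl (v ++ [b])) = (cyl v).indicator (fun s => combTheta q qinf s b) s := by
  have hθ : κ s = combTheta q qinf s false • Measure.dirac (extend false s)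
      + combTheta q qinf s true • Measure.dirac (extend true s) := by
    rcases exists_mem_contextSet_or_eq s with ⟨n, hn⟩ | rfl
    · rw [hκ.1 n s hn, combTheta_of_mem q qinf hn, combTheta_of_mem q qinf hn]
    · rw [hκ.2]
      simp [combTheta, zeroSeq]
  rw [hθ]
  simp only [Measure.add_apply, Measure.smul_apply, smul_eq_mul,
    Measure.dirac_apply' _ (measurableSet_cyl _), Set.indicator_apply, extend_mem_cyl]
  by_cases hs : s ∈ cyl v <;> cases b <;> simp [hs]

lemma measure_cyl_append_singleton (hκ : IsCombKernel q qinf κ) (hπ : IsStationary κ π)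
    {v : List Bool} {n : ℕ} (hv : cyl v ⊆ contextSet n) (b : Bool) :
    π (cyl (v ++ [b])) = π (cyl v) * q n b := by
  rw [hπ _ (measurableSet_cyl _)]
  have : ∀ s, κ s (cyl (v ++ [b])) = (cyl v).indicator (fun _ => q n b) s := by
    intro s
    rw [kernel_apply_cyl hκ]
    by_cases hs : s ∈ cyl v
    · simp [hs, combTheta_of_mem q qinf (hv hs)]
    · simp [hs]
  simp_rw [this]
  rw [lintegral_indicator_const (measurableSet_cyl _), mul_comm]

lemma measure_cyl_append (hκ : IsCombKernel q qinf κ) (hπ : IsStationary κ π)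
    (u : List Bool) {v : List Bool} {past : L} {n : ℕ} (hv : cyl v ⊆ contextSet n)
    (hp : past ∈ contextSet n) :
    π (cyl (v ++ u)) = π (cyl v) * combWordProb q qinf past u := by
  induction u generalizing v past n with
  | nil => simp [combWordProb]
  | cons b u ih =>
    rw [List.append_cons, combWordProb, combTheta_of_mem q qinf hp, ← mul_assoc,
      ← measure_cyl_append_singleton hκ hπ hv b]
    cases b
    · exact ih (cyl_append_false_subset hv) (extend_false_mem_contextSet hp)
    · exact ih (cyl_append_true_subset v) (extend_true_mem_contextSet past)

lemma measureReal_cyl_append (hκ : IsCombKernel q qinf κ) (hπ : IsStationary κ π)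
    {w v : List Bool} (hw : true ∈ w) (hv : w <:+ v) (u : List Bool) :
    (π (cyl (v ++ u))).toReal
      = (π (cyl v)).toReal * (combWordProb q qinf (combPast w) u).toReal := by
  rw [measure_cyl_append hκ hπ u ((cyl_anti hv).trans (cyl_subset_contextSet hw))
    (combPast_mem_contextSet w), ENNReal.toReal_mul]

lemma measure_cyl_cons_add (u : List Bool) :
    π (cyl (false :: u)) + π (cyl (true :: u)) = π (cyl u) := by
  have h : ∀ b, cyl (b :: u) = {s | s ∈ cyl u ∧ s u.length = b} := by
    intro b
    ext s
    simp [cyl, mem_cylRev_append_singleton]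
  rw [← measure_union _ (measurableSet_cyl _)]
  · congr 1
    ext s
    cases hb : s u.length <;> simp [h, hb]
  · rw [h, h, Set.disjoint_left]
    rintro s ⟨_, h1⟩ ⟨_, h2⟩
    simp [h1] at h2

lemma sum_measureReal_cyl [IsProbabilityMeasure π] (n : ℕ) (u : List Bool) :
    ∑ v : Fin n → Bool, (π (cyl (List.ofFn v ++ u))).toReal = (π (cyl u)).toReal := by
  induction n with
  | zero => simp
  | succ n ih =>
    rw [sum_ofFn_succ n fun l => (π (cyl (l ++ u))).toReal, ← ih]
    refine Finset.sum_congr rfl fun v _ => ?_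
    rw [← measure_cyl_cons_add (List.ofFn v ++ u),
      ENNReal.toReal_add (measure_ne_top _ _) (measure_ne_top _ _)]
    rfl

lemma combTheta_add (hq : ∀ n, q n false + q n true = 1) (hqinf : qinf false + qinf true = 1)
    (s : L) : combTheta q qinf s false + combTheta q qinf s true = 1 := by
  unfold combTheta
  split_ifs
  · exact hq _
  · exact hqinf

lemma sum_combWordProb (hq : ∀ n, q n false + q n true = 1)
    (hqinf : qinf false + qinf true = 1) (n : ℕ) (s : L) :
    ∑ v : Fin n → Bool, combWordProb q qinf s (List.ofFn v) = 1 := by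
  induction n generalizing s with
  | zero => simp [combWordProb]
  | succ n ih =>
    rw [sum_ofFn_succ, Finset.sum_add_distrib]
    simp only [combWordProb, ← Finset.mul_sum, ih, mul_one]
    exact combTheta_add hq hqinf s

lemma combWordProb_ne_top (hq : ∀ n, q n false + q n true = 1)
    (hqinf : qinf false + qinf true = 1) (s : L) (u : List Bool) :
    combWordProb q qinf s u ≠ ∞ := by
  induction u generalizing s with
  | nil => simp [combWordProb]
  | cons b u ih =>
    refine ENNReal.mul_ne_top ?_ (ih _)
    have h := combTheta_add hq hqinf s
    have h1 : combTheta q qinf s false + combTheta q qinf s true ≠ ∞ := by simp [h]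
    rw [ENNReal.add_ne_top] at h1
    cases b
    · exact h1.1
    · exact h1.2

end Chain

section Renewal

/-- The probability that `w` occurs at the `d`-th step after an occurrence of `w`. -/
noncomputable def reoccurProb (q : ℕ → Bool → ℝ≥0∞) (qinf : Bool → ℝ≥0∞) (past : L)
    (w : List Bool) (d : ℕ) : ℝ :=
  ∑ u : Fin d → Bool,
    if w <:+ w ++ List.ofFn u then (combWordProb q qinf past (List.ofFn u)).toReal else 0

/-- The probability that `w` occurs at position `n`, with at least `r` earlier occurrences. -/
noncomputable def probLateOcc (π : Measure L) (w : List Bool) (r n : ℕ) : ℝ :=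
  ∑ v : Fin n → Bool,
    if w <:+ List.ofFn v ∧ r ≤ (List.range n).countP (occursAt w (List.ofFn v)) then
      (π (cyl (List.ofFn v))).toReal else 0

variable {q : ℕ → Bool → ℝ≥0∞} {qinf : Bool → ℝ≥0∞} {κ : Kernel L L} {π : Measure L}

lemma isRthOcc_ofFn {n : ℕ} (w : List Bool) (v : Fin n → Bool) (r : ℕ) :
    isRthOcc w (List.ofFn v) (r + 1) n = true ↔
      w <:+ List.ofFn v ∧ (List.range n).countP (occursAt w (List.ofFn v)) = r := by
  have h := occursAt_length (w := w) (v := List.ofFn v)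
  rw [List.length_ofFn] at h
  simp [isRthOcc, h]

lemma probLateOcc_eq_add (w : List Bool) (r n : ℕ) :
    probLateOcc π w r n = probOcc π w (r + 1) n + probLateOcc π w (r + 1) n := by
  simp only [probLateOcc, probOcc, isRthOcc_ofFn, ← Finset.sum_add_distrib]
  refine Finset.sum_congr rfl fun v _ => ?_
  by_cases h : w <:+ List.ofFn v
  · rcases lt_trichotomy r ((List.range n).countP (occursAt w (List.ofFn v))) with h' | h' | h'
    · simp [h, h'.le, h'.ne', Nat.succ_le_of_lt h']
    · simp [h, ← h']
    · simp [h, h'.ne, not_le.mpr h', show ¬ r + 1 ≤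
        (List.range n).countP (occursAt w (List.ofFn v)) by omega]
  · simp [h]

lemma probLateOcc_zero [IsProbabilityMeasure π] (w : List Bool) (n : ℕ) :
    probLateOcc π w 0 n = if w.length ≤ n then (π (cyl w)).toReal else 0 := by
  simp only [probLateOcc, Nat.zero_le, and_true]
  split_ifs with h
  · obtain ⟨e, rfl⟩ := Nat.exists_eq_add_of_le' h
    rw [sum_ofFn_add e w.length fun l => if w <:+ l then (π (cyl l)).toReal else 0,
      ← sum_measureReal_cyl e w]
    refine Finset.sum_congr rfl fun a _ => ?_
    rw [← sum_ofFn_eq w fun l => (π (cyl (List.ofFn a ++ l))).toReal]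
    refine Finset.sum_congr rfl fun u _ => ?_
    simp only [isSuffix_append_iff_of_length_eq (w := w) (v := List.ofFn a)
      (u := List.ofFn u) (by simp)]
  · refine Finset.sum_eq_zero fun v _ => if_neg fun h' => h ?_
    simpa using h'.length_le

lemma renewal_equation (hκ : IsCombKernel q qinf κ) (hπ : IsStationary κ π)
    {w : List Bool} (hw : true ∈ w) (r n : ℕ) :
    probLateOcc π w r n = ∑ m ∈ Finset.range (n + 1),
      probOcc π w (r + 1) m * reoccurProb q qinf (combPast w) w (n - m) := by
  have h1 : probLateOcc π w r n = ∑ m ∈ Finset.range (n + 1), ∑ v : Fin n → Bool,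
      if isRthOcc w (List.ofFn v) (r + 1) m ∧ w <:+ List.ofFn v then
        (π (cyl (List.ofFn v))).toReal else 0 := by
    rw [Finset.sum_comm, probLateOcc]
    refine Finset.sum_congr rfl fun v _ => ?_
    by_cases hs : w <:+ List.ofFn v
    · have ho : occursAt w (List.ofFn v) n = true := by
        have := occursAt_length.mpr hs
        rwa [List.length_ofFn] at this
      have := sum_isRthOcc w (List.ofFn v) r (n + 1)
      rw [List.range_succ, List.countP_append, List.countP_singleton, if_pos ho] at this
      simp only [hs, and_true, true_and]
      calc _ = (if r < (List.range n).countP (occursAt w (List.ofFn v)) + 1 then (1 : ℝ) else 0)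
            * (π (cyl (List.ofFn v))).toReal := by simp
        _ = _ := by
          rw [← this, Finset.sum_mul]
          simp
    · simp [hs]
  rw [h1]
  refine Finset.sum_congr rfl fun m hm => ?_
  obtain ⟨d, rfl⟩ := Nat.exists_eq_add_of_le (Finset.mem_range_succ_iff.mp hm)
  rw [Nat.add_sub_cancel_left, sum_ofFn_add m d fun l =>
    if isRthOcc w l (r + 1) m ∧ w <:+ l then (π (cyl l)).toReal else 0, probOcc, Finset.sum_mul]
  refine Finset.sum_congr rfl fun a _ => ?_
  rw [reoccurProb, Finset.mul_sum]
  refine Finset.sum_congr rfl fun u _ => ?_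
  rw [isRthOcc_append _ (by simp)]
  by_cases ha : isRthOcc w (List.ofFn a) (r + 1) m
  · have hs := ((isRthOcc_ofFn w a r).mp ha).1
    simp only [ha, true_and, if_true, isSuffix_append_congr hs,
      measureReal_cyl_append hκ hπ hw hs, mul_ite, mul_zero]
  · simp [ha]

lemma probOcc_nonneg (w : List Bool) (r n : ℕ) : 0 ≤ probOcc π w r n :=
  Finset.sum_nonneg fun v _ => by split_ifs <;> simp

lemma probLateOcc_nonneg (w : List Bool) (r n : ℕ) : 0 ≤ probLateOcc π w r n :=
  Finset.sum_nonneg fun v _ => by split_ifs <;> simp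

lemma probLateOcc_le [IsProbabilityMeasure π] (w : List Bool) (r n : ℕ) :
    probLateOcc π w r n ≤ (π (cyl w)).toReal := by
  induction r with
  | zero =>
    rw [probLateOcc_zero]
    split_ifs <;> simp
  | succ r ih =>
    have := probLateOcc_eq_add (π := π) w r n
    have := probOcc_nonneg (π := π) w (r + 1) n
    linarith

lemma probOcc_le [IsProbabilityMeasure π] (w : List Bool) (r n : ℕ) :
    probOcc π w (r + 1) n ≤ (π (cyl w)).toReal := by
  have := probLateOcc_eq_add (π := π) w r n
  have := probLateOcc_nonneg (π := π) w (r + 1) n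
  have := probLateOcc_le (π := π) w r n
  linarith

lemma reoccurProb_nonneg (past : L) (w : List Bool) (d : ℕ) :
    0 ≤ reoccurProb q qinf past w d :=
  Finset.sum_nonneg fun v _ => by split_ifs <;> simp

lemma reoccurProb_le_one (hq : ∀ n, q n false + q n true = 1)
    (hqinf : qinf false + qinf true = 1) (past : L) (w : List Bool) (d : ℕ) :
    reoccurProb q qinf past w d ≤ 1 := by
  calc reoccurProb q qinf past w d
      ≤ ∑ u : Fin d → Bool, (combWordProb q qinf past (List.ofFn u)).toReal :=
        Finset.sum_le_sum fun u _ => by split_ifs <;> simp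
    _ = 1 := by
      rw [← ENNReal.toReal_sum fun u _ => combWordProb_ne_top hq hqinf _ _,
        sum_combWordProb hq hqinf, ENNReal.toReal_one]

lemma reoccurProb_of_le (past : L) {w : List Bool} {d : ℕ} (hd : d ≤ w.length) :
    reoccurProb q qinf past w d = if w.drop d = w.take (w.length - d) then
      (qcond q qinf past d (w.drop (w.length - d))).toReal else 0 := by
  have hlen : (w.drop (w.length - d)).length = d := by simp; omega
  have hq : qcond q qinf past d (w.drop (w.length - d))
      = combWordProb q qinf past (w.drop (w.length - d)) := by
    have h0 : d - (w.drop (w.length - d)).length = 0 := by omega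
    unfold qcond
    rw [h0]
    simp
  have hiff : ∀ u : Fin d → Bool, w <:+ w ++ List.ofFn u ↔
      w.drop d = w.take (w.length - d) ∧ List.ofFn u = w.drop (w.length - d) := by
    intro u
    have := isSuffix_self_append_iff (w := w) (u := List.ofFn u) (by simpa using hd)
    simpa only [List.length_ofFn] using this
  simp only [reoccurProb, hiff, hq]
  by_cases h : w.drop d = w.take (w.length - d)
  · rw [if_pos h]
    simp only [and_iff_right h]
    have := sum_ofFn_eq (w.drop (w.length - d)) fun l => (combWordProb q qinf past l).toReal
    rwa [hlen] at this
  · rw [if_neg h]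
    exact Finset.sum_eq_zero fun u _ => if_neg fun h' => h h'.1

lemma reoccurProb_add_length (hq : ∀ n, q n false + q n true = 1)
    (hqinf : qinf false + qinf true = 1) (past : L) (w : List Bool) (j : ℕ) :
    reoccurProb q qinf past w (j + w.length)
      = (qcond q qinf past (w.length + j) w).toReal := by
  rw [reoccurProb, sum_ofFn_add j w.length fun l =>
    if w <:+ w ++ l then (combWordProb q qinf past l).toReal else 0, qcond,
    ENNReal.toReal_sum fun u _ => combWordProb_ne_top hq hqinf _ _, Nat.add_sub_cancel_left]
  refine Finset.sum_congr rfl fun a _ => ?_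
  rw [← sum_ofFn_eq w fun l => (combWordProb q qinf past (List.ofFn a ++ l)).toReal]
  refine Finset.sum_congr rfl fun u _ => ?_
  simp only [← List.append_assoc,
    isSuffix_append_iff_of_length_eq (w := w) (v := w ++ List.ofFn a) (u := List.ofFn u) (by simp)]

lemma summable_norm_mul_pow {f : ℕ → ℝ} {C x : ℝ} (hf : ∀ n, 0 ≤ f n) (hC : ∀ n, f n ≤ C)
    (hx : |x| < 1) : Summable fun n => ‖f n * x ^ n‖ := by
  refine Summable.of_nonneg_of_le (fun _ => norm_nonneg _) (fun n => ?_)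
    ((summable_geometric_of_lt_one (abs_nonneg x) hx).mul_left C)
  rw [norm_mul, norm_pow, Real.norm_eq_abs, Real.norm_eq_abs, abs_of_nonneg (hf n)]
  exact mul_le_mul_of_nonneg_right (hC n) (by positivity)

lemma Sw_eq_tsum (hq : ∀ n, q n false + q n true = 1) (hqinf : qinf false + qinf true = 1)
    (past : L) {w : List Bool} (hw : w ≠ []) {x : ℝ} (hx : |x| < 1) :
    Sw q qinf past w x = ∑' d, reoccurProb q qinf past w d * x ^ d := by
  have hs := (summable_norm_mul_pow (reoccurProb_nonneg (q := q) (qinf := qinf) past w)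
    (reoccurProb_le_one hq hqinf past w) hx).of_norm
  rw [← hs.sum_add_tsum_nat_add w.length, Sw, Cw]
  congr 1
  · rw [Finset.range_eq_Ico,
      Finset.sum_eq_sum_Ico_succ_bot (List.length_pos_iff.mpr hw)]
    congr 1
    · simp [reoccurProb, combWordProb]
    · refine Finset.sum_congr rfl fun j hj => ?_
      rw [reoccurProb_of_le past (Finset.mem_Ico.mp hj).2.le]
      split_ifs <;> simp
  · refine tsum_congr fun j => ?_
    rw [reoccurProb_add_length hq hqinf, add_comm j]

lemma genFun_mul_Sw [IsProbabilityMeasure π] (hq : ∀ n, q n false + q n true = 1)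
    (hqinf : qinf false + qinf true = 1) (hκ : IsCombKernel q qinf κ) (hπ : IsStationary κ π)
    {w : List Bool} (hw : true ∈ w) {x : ℝ} (hx : |x| < 1) (r : ℕ) :
    genFun π w (r + 1) x * Sw q qinf (combPast w) w x
      = ∑' n, probLateOcc π w r n * x ^ n := by
  rw [Sw_eq_tsum hq hqinf _ (List.ne_nil_of_mem hw) hx, genFun,
    tsum_mul_tsum_eq_tsum_sum_range_of_summable_norm
      (summable_norm_mul_pow (probOcc_nonneg w (r + 1)) (probOcc_le w r) hx)
      (summable_norm_mul_pow (reoccurProb_nonneg _ w) (reoccurProb_le_one hq hqinf _ w) hx)]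
  refine tsum_congr fun n => ?_
  rw [renewal_equation hκ hπ hw, Finset.sum_mul]
  refine Finset.sum_congr rfl fun m hm => ?_
  rw [mul_mul_mul_comm, ← pow_add, Nat.add_sub_cancel' (Finset.mem_range_succ_iff.mp hm)]

lemma tsum_probLateOcc_eq_add [IsProbabilityMeasure π] (w : List Bool) {x : ℝ} (hx : |x| < 1)
    (r : ℕ) : ∑' n, probLateOcc π w r n * x ^ n
      = genFun π w (r + 1) x + ∑' n, probLateOcc π w (r + 1) n * x ^ n := by
  rw [genFun, ← Summable.tsum_add
    (summable_norm_mul_pow (probOcc_nonneg w (r + 1)) (probOcc_le w r) hx).of_norm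
    (summable_norm_mul_pow (probLateOcc_nonneg w (r + 1)) (probLateOcc_le w (r + 1)) hx).of_norm]
  exact tsum_congr fun n => by rw [probLateOcc_eq_add, add_mul]

lemma tsum_probLateOcc_zero [IsProbabilityMeasure π] (w : List Bool) {x : ℝ} (hx : |x| < 1) :
    ∑' n, probLateOcc π w 0 n * x ^ n = x ^ w.length * (π (cyl w)).toReal / (1 - x) := by
  have hs := (summable_norm_mul_pow (probLateOcc_nonneg (π := π) w 0)
    (probLateOcc_le w 0) hx).of_norm
  rw [← hs.sum_add_tsum_nat_add w.length, Finset.sum_eq_zero, zero_add]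
  · have : ∀ i, probLateOcc π w 0 (i + w.length) * x ^ (i + w.length)
        = (π (cyl w)).toReal * x ^ w.length * x ^ i := fun i => by
      rw [probLateOcc_zero, if_pos (by omega), pow_add]; ring
    simp_rw [this]
    rw [tsum_mul_left, tsum_geometric_of_abs_lt_one hx, div_eq_mul_inv,
      mul_comm (π (cyl w)).toReal]
  · intro i hi
    rw [probLateOcc_zero, if_neg (by simpa using hi), zero_mul]

lemma genFun_eq_zero [IsProbabilityMeasure π] {w : List Bool} (h : (π (cyl w)).toReal = 0)
    (r : ℕ) (x : ℝ) : genFun π w (r + 1) x = 0 := by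
  have : ∀ n, probOcc π w (r + 1) n = 0 := fun n =>
    le_antisymm (h ▸ probOcc_le w r n) (probOcc_nonneg w (r + 1) n)
  simp [genFun, this]

lemma Sw_zero (past : L) {w : List Bool} (hw : w ≠ []) : Sw q qinf past w 0 = 1 := by
  have h : ∀ j ∈ Finset.Ico 1 w.length, (if w.drop j = w.take (w.length - j) then
       (qcond q qinf past j (w.drop (w.length - j))).toReal * (0 : ℝ) ^ j
     else 0) = 0 := fun j hj => by
    have : j ≠ 0 := by have := (Finset.mem_Ico.mp hj).1; omega
    simp [this]
  rw [Sw, Cw, Finset.sum_eq_zero h]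
  simp [hw]

end Renewal

/-- (Generating functions of word occurrences, infinite comb.)
For a SVLMC defined by an irreducible probabilized infinite comb and a word
`w = w₁…w_k` (`k ≥ 1`) whose reversed word is not an internal node (i.e. `w`
contains the letter `1`), for `|x| < 1` :
`Φ_w⁽¹⁾(x) = x^k π(w) / ((1-x) S_w(x))` and
`Φ_w⁽ʳ⁾(x) = Φ_w⁽¹⁾(x) (1 - 1/S_w(x))^{r-1}`. -/
theorem comb_occurrence_generating_function
    (q : ℕ → Bool → ℝ≥0∞) (qinf : Bool → ℝ≥0∞)
    (hq : ∀ n, q n false + q n true = 1) (hqinf : qinf false + qinf true = 1)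
    (hirr : qinf false ≠ 1) (hconv : (∑' n, combC q n) ≠ ∞)
    (κ : Kernel L L) [IsMarkovKernel κ] (hκ : IsCombKernel q qinf κ)
    (π : Measure L) [IsProbabilityMeasure π] (hπ : IsStationary κ π)
    (w : List Bool) (hw : true ∈ w)
    (x : ℝ) (hx : |x| < 1) :
    genFun π w 1 x
      = x ^ w.length * (π (cyl w)).toReal
          / ((1 - x) * Sw q qinf (combPast w) w x) ∧
    ∀ r : ℕ, 1 ≤ r →
      genFun π w r x
        = genFun π w 1 x * (1 - 1 / Sw q qinf (combPast w) w x) ^ (r - 1) := by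
  have hx1 : 1 - x ≠ 0 := by have := (abs_lt.mp hx).2; linarith
  have hmul := fun r => genFun_mul_Sw (r := r) hq hqinf hκ hπ hw hx
  have hfirst : genFun π w 1 x * Sw q qinf (combPast w) w x
      = x ^ w.length * (π (cyl w)).toReal / (1 - x) := by
    rw [← tsum_probLateOcc_zero w hx]
    exact hmul 0
  by_cases hw0 : (π (cyl w)).toReal = 0
  · refine ⟨by simp [hw0, genFun_eq_zero hw0 0 x], fun r hr => ?_⟩
    obtain ⟨r, rfl⟩ := Nat.exists_eq_add_of_le' hr
    rw [genFun_eq_zero hw0 r x, genFun_eq_zero hw0 0 x, zero_mul]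
  have hS : Sw q qinf (combPast w) w x ≠ 0 := by
    intro hS
    by_cases hx0 : x = 0
    · rw [hx0, Sw_zero _ (List.ne_nil_of_mem hw)] at hS
      exact one_ne_zero hS
    · rw [hS, mul_zero] at hfirst
      exact div_ne_zero (mul_ne_zero (pow_ne_zero _ hx0) hw0) hx1 hfirst.symm
  refine ⟨?_, fun r hr => ?_⟩
  · rw [← div_div, ← hfirst, mul_div_cancel_right₀ _ hS]
  · induction r, hr using Nat.le_induction with
    | base => simp
    | succ r hr ih =>
      obtain ⟨r, rfl⟩ := Nat.exists_eq_add_of_le' hr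
      have h := tsum_probLateOcc_eq_add (π := π) w hx r
      rw [← hmul r, ← hmul (r + 1)] at h
      have hstep : genFun π w (r + 1 + 1) x
          = genFun π w (r + 1) x * (1 - 1 / Sw q qinf (combPast w) w x) := by
        field_simp
        linarith
      rw [hstep, ih, mul_assoc, ← pow_succ]
      rfl

end VLMC
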